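/- There exist absolute constants c > 0 and C > 0 with the following property. Let G be an abelian group, A a finite subset of G with |A| ≥ 2, and M ≥ 1 a real number such that T₄(A) ≥ |A|⁴·E(A)/M. Then there is a subset A' ⊆ A with |A'| ≥ c·|A|/(M³·(log₂|A|)^{16/3}) such that for all integers n, m ≥ 1 one has |nA' − mA'| ≤ (C·M³·(log₂|A|)⁴)^{4(n+m)} · M · (|A|³/E(A)) · |A'|. -/

import Mathlib

open Finset Pointwise

universe u

variable {G : Type*} [AddCommGroup G] [DecidableEq G]

/-- `A_s = A ∩ (A - s) = {x ∈ A : x + s ∈ A}`. -/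
def stab (A : Finset G) (s : G) : Finset G := A ∩ A.image (fun a => a - s)

/-- `E_k(A) = ∑_{s ∈ G} |A_s|^k` (the summand vanishes off `A - A`). -/
def energyK (k : ℕ) (A : Finset G) : ℕ := ∑ s ∈ A - A, (stab A s).card ^ k

/-- The additive energy `E(A)`. -/
def energy (A : Finset G) : ℕ := energyK 2 A

/-- `T_k(A)`: the number of `2k`-tuples of elements of `A` with
`a₁ + ⋯ + a_k = a₁' + ⋯ + a_k'`. -/
def Tk (k : ℕ) (A : Finset G) : ℕ :=
  (((Fintype.piFinset fun _ : Fin k => A) ×ˢ (Fintype.piFinset fun _ : Fin k => A)).filter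
    (fun p => ∑ i, p.1 i = ∑ i, p.2 i)).card

/-- `iterSum A n = A + A + ⋯ + A` (`n` summands); `iterSum A 0 = {0}`. -/
def iterSum (A : Finset G) : ℕ → Finset G
  | 0 => {0}
  | n + 1 => iterSum A n + A

/-- Sum of a nonnegative function supported in `D` along an injective map. -/
lemma aux_sum {ι : Type*} (T : Finset ι) (D : Finset G) (h : G → ℝ) (e : ι → G)
    (he : Function.Injective e) (h0 : ∀ x, 0 ≤ h x) (hD : ∀ x, x ∉ D → h x = 0) :
    ∑ s ∈ T, h (e s) ≤ ∑ x ∈ D, h x := by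
  classical
  rw [← Finset.sum_image (s := T) (g := e) (f := h) (fun a _ b _ hab => he hab)]
  rw [← Finset.sum_subset (s₁ := T.image e ∩ D) (s₂ := T.image e) Finset.inter_subset_left
    (fun x hx hx' => hD x (fun h' => hx' (Finset.mem_inter.2 ⟨hx, h'⟩)))]
  exact Finset.sum_le_sum_of_subset_of_nonneg Finset.inter_subset_right (fun x _ _ => h0 x)

/-- correlation -/
def corr (D : Finset G) (f : G → ℝ) (t : G) : ℝ := ∑ x ∈ D, f x * f (x + t)

lemma corr_nonneg (D : Finset G) (f : G → ℝ) (f0 : ∀ x, 0 ≤ f x) (t : G) : 0 ≤ corr D f t :=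
  Finset.sum_nonneg fun x _ => mul_nonneg (f0 x) (f0 _)

lemma corr_supp (D : Finset G) (f : G → ℝ) (fD : ∀ x, x ∉ D → f x = 0) (t : G)
    (ht : t ∉ D - D) : corr D f t = 0 := by
  refine Finset.sum_eq_zero fun x hx => ?_
  rw [fD (x + t), mul_zero]
  intro h
  exact ht (by simpa using Finset.sub_mem_sub h hx)

lemma corr_le (D : Finset G) (f : G → ℝ) (f0 : ∀ x, 0 ≤ f x) (fD : ∀ x, x ∉ D → f x = 0)
    (T : Finset G) (a b : G) : ∑ s ∈ T, f (a + s) * f (b + s) ≤ corr D f (b - a) := by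
  have := aux_sum T D (fun x => f x * f (x + (b - a))) (fun s => a + s)
    (add_right_injective a) (fun x => mul_nonneg (f0 _) (f0 _))
    (fun x hx => by simp [fD x hx])
  refine le_trans (le_of_eq ?_) this
  refine Finset.sum_congr rfl fun s _ => ?_
  congr 2
  abel

lemma corr_neg_le (D : Finset G) (f : G → ℝ) (f0 : ∀ x, 0 ≤ f x) (fD : ∀ x, x ∉ D → f x = 0)
    (t : G) : corr D f t ≤ corr D f (-t) := by
  have := corr_le D f f0 fD D t 0
  refine le_trans (le_of_eq ?_) (this.trans (by simp))
  refine Finset.sum_congr rfl fun s _ => ?_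
  rw [zero_add, mul_comm, add_comm]

lemma corr_neg (D : Finset G) (f : G → ℝ) (f0 : ∀ x, 0 ≤ f x) (fD : ∀ x, x ∉ D → f x = 0)
    (t : G) : corr D f (-t) = corr D f t :=
  le_antisymm (by simpa using corr_neg_le D f f0 fD (-t)) (corr_neg_le D f f0 fD t)

lemma corr_sum (D : Finset G) (f : G → ℝ) (f0 : ∀ x, 0 ≤ f x) (fD : ∀ x, x ∉ D → f x = 0)
    (T : Finset G) : ∑ s ∈ T, corr D f s ≤ (∑ x ∈ D, f x) ^ 2 := by
  unfold corr
  rw [Finset.sum_comm, sq, Finset.sum_mul]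
  refine Finset.sum_le_sum fun x _ => ?_
  rw [← Finset.mul_sum]
  exact mul_le_mul_of_nonneg_left
    (aux_sum T D f (fun s => x + s) (add_right_injective x) f0 fD) (f0 x)

/-- Weighted Balog-Szemeredi-Gowers. -/
lemma core (D : Finset G) (f : G → ℝ) (f0 : ∀ x, 0 ≤ f x) (fD : ∀ x, x ∉ D → f x = 0)
    (h S Q : ℝ) (hh : 0 < h) (hS : 0 < S) (hQ : 0 < Q) (fh : ∀ x, f x ≤ h)
    (fS : ∑ x ∈ D, f x ≤ S)
    (hE : S ^ 2 * Q ≤ ∑ s ∈ D - D, corr D f s ^ 2) :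
    ∃ V ⊆ D, Q ≤ 4 * h * ∑ x ∈ V, f x ∧
      ((V - V).card : ℝ) * Q ^ 3 ≤ 4096 * h ^ 2 * S ^ 4 := by
  classical
  set F := corr D f with hF
  have F0 : ∀ t, 0 ≤ F t := corr_nonneg D f f0
  have FD : ∀ t, t ∉ D - D → F t = 0 := corr_supp D f fD
  have Fneg : ∀ t, F (-t) = F t := corr_neg D f f0 fD
  have fS0 : 0 ≤ ∑ x ∈ D, f x := Finset.sum_nonneg fun x _ => f0 x
  have fS2 : (∑ x ∈ D, f x) ^ 2 ≤ S ^ 2 := pow_le_pow_left₀ fS0 fS 2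
  have FS : ∀ T : Finset G, ∑ s ∈ T, F s ≤ S ^ 2 := fun T =>
    (corr_sum D f f0 fD T).trans fS2
  set P := (D - D).filter (fun s => Q / 2 ≤ F s) with hP
  have hPE : S ^ 2 * Q / 2 ≤ ∑ s ∈ P, F s ^ 2 := by
    have h1 := Finset.sum_filter_add_sum_filter_not (D - D) (fun s => Q / 2 ≤ F s)
      (fun s => F s ^ 2)
    have h2 : ∑ s ∈ (D - D).filter (fun s => ¬ Q / 2 ≤ F s), F s ^ 2 ≤ Q / 2 * S ^ 2 := by
      calc _ ≤ ∑ s ∈ (D - D).filter (fun s => ¬ Q / 2 ≤ F s), Q / 2 * F s := by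
            refine Finset.sum_le_sum fun s hs => ?_
            rw [Finset.mem_filter, not_le] at hs
            rw [sq]
            exact mul_le_mul_of_nonneg_right hs.2.le (F0 s)
        _ ≤ _ := by
            rw [← Finset.mul_sum]
            exact mul_le_mul_of_nonneg_left (FS _) (by positivity)
    linarith
  have hSQ : 0 < S ^ 2 * Q := by positivity
  have Pne : P.Nonempty := by
    rw [Finset.nonempty_iff_ne_empty]
    intro h'
    rw [h'] at hPE
    simp at hPE
    linarith
  set bad : G → ℝ := fun s => ∑ a ∈ D, ∑ c ∈ D,
    if F (c - a) < Q / 32 then (f a * f (a + s)) * (f c * f (c + s)) else 0 with hbad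
  have hbadsum : ∑ s ∈ P, bad s ≤ ∑ s ∈ P, F s ^ 2 / 16 := by
    have : ∑ s ∈ P, bad s ≤ Q / 32 * S ^ 2 := by
      calc ∑ s ∈ P, bad s = ∑ a ∈ D, ∑ c ∈ D, ∑ s ∈ P,
            (if F (c - a) < Q / 32 then (f a * f (a + s)) * (f c * f (c + s)) else 0) := by
            simp only [hbad]
            rw [Finset.sum_comm]
            refine Finset.sum_congr rfl fun a _ => ?_
            rw [Finset.sum_comm]
        _ ≤ ∑ a ∈ D, ∑ c ∈ D, f a * f c * (Q / 32) := by
            refine Finset.sum_le_sum fun a _ => Finset.sum_le_sum fun c _ => ?_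
            split_ifs with hc
            · calc _ = f a * f c * ∑ s ∈ P, f (a + s) * f (c + s) := by
                    rw [Finset.mul_sum]
                    exact Finset.sum_congr rfl fun s _ => by ring
                _ ≤ _ := mul_le_mul_of_nonneg_left
                    ((corr_le D f f0 fD P a c).trans hc.le) (mul_nonneg (f0 a) (f0 c))
            · simp only [Finset.sum_const_zero]
              have := mul_nonneg (f0 a) (f0 c)
              positivity
        _ = Q / 32 * (∑ x ∈ D, f x) ^ 2 := by
            rw [sq, Finset.sum_mul_sum, Finset.mul_sum]
            refine Finset.sum_congr rfl fun a _ => ?_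
            rw [Finset.mul_sum]
            exact Finset.sum_congr rfl fun c _ => by ring
        _ ≤ _ := mul_le_mul_of_nonneg_left fS2 (by positivity)
    rw [← Finset.sum_div]
    linarith
  obtain ⟨s, hsP, hs⟩ := Finset.exists_le_of_sum_le Pne hbadsum
  have hFs : Q / 2 ≤ F s := (Finset.mem_filter.1 hsP).2
  have hFs0 : 0 < F s := by linarith
  set w : G → ℝ := fun x => f x * f (x + s) with hw
  have w0 : ∀ x, 0 ≤ w x := fun x => mul_nonneg (f0 _) (f0 _)
  have wF : ∑ x ∈ D, w x = F s := rfl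
  set b : G → ℝ := fun a => ∑ c ∈ D, if F (c - a) < Q / 32 then w c else 0 with hb
  have b0 : ∀ a, 0 ≤ b a := fun a => Finset.sum_nonneg fun c _ => by
    split_ifs
    exacts [w0 c, le_rfl]
  have hbadb : bad s = ∑ a ∈ D, w a * b a := by
    simp only [hbad, hb, hw]
    refine Finset.sum_congr rfl fun a _ => ?_
    rw [Finset.mul_sum]
    refine Finset.sum_congr rfl fun c _ => ?_
    split_ifs <;> simp
  set V := D.filter (fun a => b a ≤ F s / 4) with hV
  have hVw : 3 / 4 * F s ≤ ∑ x ∈ V, w x := by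
    have h1 := Finset.sum_filter_add_sum_filter_not D (fun a => b a ≤ F s / 4) w
    have h2 : (∑ x ∈ D.filter (fun a => ¬ b a ≤ F s / 4), w x) * (F s / 4) ≤ F s ^ 2 / 16 := by
      calc _ ≤ ∑ x ∈ D.filter (fun a => ¬ b a ≤ F s / 4), w x * b x := by
            rw [Finset.sum_mul]
            refine Finset.sum_le_sum fun x hx => ?_
            rw [Finset.mem_filter, not_le] at hx
            exact mul_le_mul_of_nonneg_left hx.2.le (w0 x)
        _ ≤ ∑ x ∈ D, w x * b x :=
            Finset.sum_le_sum_of_subset_of_nonneg (Finset.filter_subset _ _)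
              (fun x _ _ => mul_nonneg (w0 x) (b0 x))
        _ ≤ _ := by rw [← hbadb]; exact hs
    have h3 : ∑ x ∈ D.filter (fun a => ¬ b a ≤ F s / 4), w x ≤ F s / 4 := by
      by_contra hcon
      rw [not_le] at hcon
      nlinarith
    rw [wF] at h1
    linarith
  refine ⟨V, Finset.filter_subset _ _, ?_, ?_⟩
  · have : ∑ x ∈ V, w x ≤ h * ∑ x ∈ V, f x := by
      rw [Finset.mul_sum]
      refine Finset.sum_le_sum fun x _ => ?_
      rw [mul_comm h]
      exact mul_le_mul_of_nonneg_left (fh _) (f0 x)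
    linarith
  · have key : ∀ a ∈ V, ∀ a' ∈ V, Q ^ 3 / 4096 ≤
        ∑ c ∈ D, w c * (F (c - a) * F (a' - c)) := by
      intro a ha a' ha'
      have ha1 : b a ≤ F s / 4 := (Finset.mem_filter.1 ha).2
      have ha2 : b a' ≤ F s / 4 := (Finset.mem_filter.1 ha').2
      have h1 : F s ≤ b a + b a' + ∑ c ∈ D,
          (if Q / 32 ≤ F (c - a) ∧ Q / 32 ≤ F (a' - c) then w c else 0) := by
        rw [← wF, hb, ← Finset.sum_add_distrib, ← Finset.sum_add_distrib]
        refine Finset.sum_le_sum fun c _ => ?_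
        have e : F (a' - c) = F (c - a') := by rw [← Fneg, neg_sub]
        rw [e]
        have := w0 c
        split_ifs <;> first | linarith | (exfalso; grind)
      have h2 : (∑ c ∈ D,
          (if Q / 32 ≤ F (c - a) ∧ Q / 32 ≤ F (a' - c) then w c else 0)) * (Q / 32 * (Q / 32))
            ≤ ∑ c ∈ D, w c * (F (c - a) * F (a' - c)) := by
        rw [Finset.sum_mul]
        refine Finset.sum_le_sum fun c _ => ?_
        split_ifs with hc
        · refine mul_le_mul_of_nonneg_left ?_ (w0 c)
          exact mul_le_mul hc.1 hc.2 (by positivity) (F0 _)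
        · rw [zero_mul]
          exact mul_nonneg (w0 _) (mul_nonneg (F0 _) (F0 _))
      have h3 : Q / 4 ≤ ∑ c ∈ D,
          (if Q / 32 ≤ F (c - a) ∧ Q / 32 ≤ F (a' - c) then w c else 0) := by linarith
      have h4 : Q / 4 * (Q / 32 * (Q / 32)) ≤ _ :=
        le_trans (mul_le_mul_of_nonneg_right h3 (by positivity)) h2
      refine le_trans (le_of_eq ?_) h4
      ring
    have key2 : ∀ d ∈ V - V, Q ^ 3 / 4096 ≤
        h ^ 2 * ∑ t ∈ D - D, F t * F (d - t) := by
      intro d hd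
      obtain ⟨a', ha', a, ha, rfl⟩ := Finset.mem_sub.1 hd
      refine (key a ha a' ha').trans ?_
      calc _ ≤ ∑ c ∈ D, h ^ 2 * (F (c - a) * F (a' - c)) := by
            refine Finset.sum_le_sum fun c _ => ?_
            refine mul_le_mul_of_nonneg_right ?_ (mul_nonneg (F0 _) (F0 _))
            rw [sq]
            exact mul_le_mul (fh _) (fh _) (f0 _) hh.le
        _ = h ^ 2 * ∑ c ∈ D, F (c - a) * F (a' - a - (c - a)) := by
            rw [Finset.mul_sum]
            refine Finset.sum_congr rfl fun c _ => ?_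
            rw [sub_sub_sub_cancel_right]
        _ ≤ _ := by
            refine mul_le_mul_of_nonneg_left ?_ (by positivity)
            exact aux_sum D (D - D) (fun t => F t * F (a' - a - t)) (fun c => c - a)
              (sub_left_injective) (fun t => mul_nonneg (F0 _) (F0 _))
              (fun t ht => by simp [FD t ht])
    have h5 := Finset.sum_le_sum key2
    rw [Finset.sum_const, nsmul_eq_mul, ← Finset.mul_sum, Finset.sum_comm] at h5
    have h6 : ∑ t ∈ D - D, ∑ d ∈ V - V, F t * F (d - t) ≤ S ^ 2 * S ^ 2 := by
      calc _ ≤ ∑ t ∈ D - D, F t * S ^ 2 := by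
            refine Finset.sum_le_sum fun t _ => ?_
            rw [← Finset.mul_sum]
            refine mul_le_mul_of_nonneg_left ?_ (F0 t)
            exact (aux_sum (V - V) (D - D) F (fun d => d - t) sub_left_injective F0 FD).trans
              (FS _)
        _ ≤ _ := by
            rw [← Finset.sum_mul]
            exact mul_le_mul_of_nonneg_right (FS _) (by positivity)
    have h7 := mul_le_mul_of_nonneg_left h6 (by positivity : 0 ≤ h ^ 2)
    have h8 : ((V - V).card : ℝ) * (Q ^ 3 / 4096) ≤ h ^ 2 * (S ^ 2 * S ^ 2) := h5.trans h7
    nlinarith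

lemma mem_stab' (A : Finset G) (s x : G) : x ∈ stab A s ↔ x ∈ A ∧ x + s ∈ A := by
  unfold stab
  simp only [Finset.mem_inter, Finset.mem_image]
  constructor
  · rintro ⟨h1, a, ha, rfl⟩
    exact ⟨h1, by simpa using ha⟩
  · rintro ⟨h1, h2⟩
    exact ⟨h1, _, h2, by simp⟩

lemma stab_supp (A : Finset G) (s : G) (hs : s ∉ A - A) : (stab A s).card = 0 := by
  rw [Finset.card_eq_zero, Finset.eq_empty_iff_forall_notMem]
  intro x hx
  rw [mem_stab'] at hx
  exact hs (by simpa using Finset.sub_mem_sub hx.2 hx.1)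

lemma sum_stab (A : Finset G) : ∑ s ∈ A - A, (stab A s).card ≤ A.card ^ 2 := by
  have h := Finset.card_eq_sum_card_fiberwise (s := A ×ˢ A) (t := A - A)
    (f := fun p => p.2 - p.1) (by
      intro p hp
      simp only [Finset.coe_product, Set.mem_prod, Finset.mem_coe] at hp ⊢
      exact Finset.sub_mem_sub hp.2 hp.1)
  rw [Finset.card_product, ← sq] at h
  rw [h]
  refine Finset.sum_le_sum fun s _ => ?_
  refine Finset.card_le_card_of_injOn (fun a => (a, a + s)) ?_ ?_
  · intro a ha
    have ha := (mem_stab' A s a).1 (Finset.mem_coe.1 ha)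
    simp [ha.1, ha.2]
  · intro a _ b _ hab
    exact (Prod.ext_iff.1 hab).1

/-- quadruples with given alternating sum -/
def quad (A : Finset G) (s : G) : Finset (G × G × G × G) :=
  (A ×ˢ A ×ˢ A ×ˢ A).filter (fun p => (p.2.2.2 - p.2.2.1) - (p.2.1 - p.1) = s)

lemma mem_quad (A : Finset G) (s a b c d : G) : (a, b, c, d) ∈ quad A s ↔
    (a ∈ A ∧ b ∈ A ∧ c ∈ A ∧ d ∈ A) ∧ (d - c) - (b - a) = s := by
  simp [quad]

lemma quad_card (A : Finset G) (s : G) :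
    (quad A s).card ≤ ∑ x ∈ A - A, (stab A x).card * (stab A (x + s)).card := by
  have h := Finset.card_eq_sum_card_fiberwise (s := quad A s) (t := A - A)
    (f := fun p => p.2.1 - p.1) (by
      rintro ⟨a, b, c, d⟩ hp
      have hp := (mem_quad A s a b c d).1 (Finset.mem_coe.1 hp)
      exact Finset.mem_coe.2 (Finset.sub_mem_sub hp.1.2.1 hp.1.1))
  rw [h]
  refine Finset.sum_le_sum fun x _ => ?_
  rw [← Finset.card_product]
  refine Finset.card_le_card_of_injOn (fun p => (p.1, p.2.2.1)) ?_ ?_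
  · rintro ⟨a, b, c, d⟩ hp
    have hp := Finset.mem_filter.1 (Finset.mem_coe.1 hp)
    have hq := (mem_quad A s a b c d).1 hp.1
    have hx : b - a = x := hp.2
    have hb : a + x = b := by rw [← hx]; abel
    have hd : c + (x + s) = d := by rw [← hq.2, hx]; abel
    simp only [Finset.coe_product, Set.mem_prod, Finset.mem_coe, mem_stab', hb, hd]
    tauto
  · rintro ⟨a, b, c, d⟩ hp ⟨a', b', c', d'⟩ hp' heq
    have hp := Finset.mem_filter.1 (Finset.mem_coe.1 hp)
    have hq := (mem_quad A s a b c d).1 hp.1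
    have hx : b - a = x := hp.2
    have hp' := Finset.mem_filter.1 (Finset.mem_coe.1 hp')
    have hq' := (mem_quad A s a' b' c' d').1 hp'.1
    have hx' : b' - a' = x := hp'.2
    have hb : a + x = b := by rw [← hx]; abel
    have hd : c + (x + s) = d := by rw [← hq.2, hx]; abel
    have hb' : a' + x = b' := by rw [← hx']; abel
    have hd' : c' + (x + s) = d' := by rw [← hq'.2, hx']; abel
    simp only [Prod.mk.injEq] at heq
    obtain ⟨rfl, rfl⟩ := heq
    rw [← hb, ← hd, ← hb', ← hd']

lemma Tk_le (A : Finset G) :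
    Tk 4 A ≤ ∑ s ∈ (A - A) - (A - A), (quad A s).card ^ 2 := by
  unfold Tk
  rw [Finset.card_eq_sum_card_fiberwise (t := (A - A) - (A - A))
    (f := fun p : (Fin 4 → G) × (Fin 4 → G) => (p.1 0 - p.2 0) - (p.2 1 - p.1 1)) (by
      rintro ⟨p, q⟩ hp
      simp only [Finset.coe_filter, Finset.mem_product, Fintype.mem_piFinset,
        Set.mem_setOf_eq] at hp
      exact Finset.mem_coe.2 (Finset.sub_mem_sub (Finset.sub_mem_sub (hp.1.1 0) (hp.1.2 0))
        (Finset.sub_mem_sub (hp.1.2 1) (hp.1.1 1))))]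
  refine Finset.sum_le_sum fun s _ => ?_
  rw [sq, ← Finset.card_product]
  refine Finset.card_le_card_of_injOn
    (fun p => ((p.1 1, p.2 1, p.2 0, p.1 0), (p.2 3, p.1 3, p.1 2, p.2 2))) ?_ ?_
  · rintro ⟨p, q⟩ hp
    simp only [Finset.coe_filter, Finset.mem_filter, Finset.mem_product, Fintype.mem_piFinset,
        Set.mem_setOf_eq, Fin.sum_univ_four] at hp
    obtain ⟨⟨⟨hp, hq⟩, he⟩, hs⟩ := hp
    simp only [Finset.coe_product, Set.mem_prod, Finset.mem_coe, mem_quad]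
    refine ⟨⟨⟨hp _, hq _, hq _, hp _⟩, hs⟩, ⟨⟨hq _, hp _, hp _, hq _⟩, ?_⟩⟩
    rw [← hs]
    have h0 : p 0 = q 0 + q 1 + q 2 + q 3 - p 1 - p 2 - p 3 := by rw [← he]; abel
    rw [h0]
    abel
  · rintro ⟨p, q⟩ _ ⟨p', q'⟩ _ heq
    simp only [Prod.mk.injEq] at heq
    obtain ⟨⟨h1, h2, h3, h4⟩, h5, h6, h7, h8⟩ := heq
    refine Prod.ext ?_ ?_
    · funext i
      fin_cases i <;> assumption
    · funext i
      fin_cases i <;> assumption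

lemma iterSum_subset (A V : Finset G) (a : G) (h : A ⊆ V + {a}) (n : ℕ) :
    iterSum A n ⊆ n • V + {n • a} := by
  induction n with
  | zero => simp [iterSum]
  | succ n ih =>
    have := Finset.add_subset_add ih h
    refine this.trans (subset_of_eq ?_)
    rw [succ_nsmul, succ_nsmul, ← Finset.singleton_add_singleton]
    abel

lemma iter_card (A V : Finset G) (a : G) (h : A ⊆ V + {a}) (n m : ℕ) :
    (iterSum A n - iterSum A m).card ≤ (n • V - m • V).card := by
  have h1 := Finset.sub_subset_sub (iterSum_subset A V a h n) (iterSum_subset A V a h m)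
  have h2 : (n • V + {n • a}) - (m • V + {m • a}) ⊆ (n • V - m • V) + {n • a - m • a} := by
    intro x hx
    obtain ⟨y, hy, z, hz, rfl⟩ := Finset.mem_sub.1 hx
    obtain ⟨y1, hy1, y2, hy2, rfl⟩ := Finset.mem_add.1 hy
    obtain ⟨z1, hz1, z2, hz2, rfl⟩ := Finset.mem_add.1 hz
    rw [Finset.mem_singleton] at hy2 hz2
    subst hy2 hz2
    rw [add_sub_add_comm]
    exact Finset.add_mem_add (Finset.sub_mem_sub hy1 hz1) (Finset.mem_singleton_self _)
  refine (Finset.card_le_card (h1.trans h2)).trans ?_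
  rw [Finset.card_add_singleton]

lemma exists_shift (A V : Finset G) (hA : A.Nonempty) : ∃ a ∈ A,
    (∑ v ∈ V, ((stab A v).card : ℝ)) ≤ A.card * ((A.filter (fun x => x - a ∈ V)).card : ℝ) := by
  have h1 : ∑ v ∈ V, (stab A v).card ≤ ∑ a ∈ A, (A.filter (fun x => x - a ∈ V)).card := by
    have e : ∀ v, stab A v = A.filter (fun a => a + v ∈ A) := by
      intro v
      ext x
      rw [mem_stab', Finset.mem_filter]
    calc ∑ v ∈ V, (stab A v).card = ∑ a ∈ A, (V.filter (fun v => a + v ∈ A)).card := by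
          simp only [e, Finset.card_filter]
          rw [Finset.sum_comm]
      _ ≤ _ := by
          refine Finset.sum_le_sum fun a _ => ?_
          refine Finset.card_le_card_of_injOn (fun v => a + v) ?_ ?_
          · intro v hv
            simp only [Finset.coe_filter, Set.mem_setOf_eq] at hv ⊢
            exact ⟨hv.2, by simpa using hv.1⟩
          · intro v _ w _ hvw
            exact add_right_injective a hvw
  obtain ⟨a, ha, hmax⟩ := Finset.exists_max_image A
    (fun a => (A.filter (fun x => x - a ∈ V)).card) hA
  refine ⟨a, ha, ?_⟩
  have h2 := Finset.sum_le_card_nsmul A _ _ hmax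
  rw [smul_eq_mul] at h2
  exact_mod_cast h1.trans h2

/-- Main step, everything except the final bookkeeping. -/
lemma main_step (A : Finset G) (M : ℝ) (hA : A.Nonempty) (hM : 1 ≤ M)
    (hT : (A.card : ℝ) ^ 4 * (energy A : ℝ) / M ≤ (Tk 4 A : ℝ)) :
    0 < (energy A : ℝ) ∧ ∃ (f : G → ℝ) (V : Finset G) (h Q : ℝ),
      h = 8 * energy A * M / (A.card : ℝ) ^ 2 ∧ Q = energy A / (2 * M) ∧
      (∀ x, f x ≤ h) ∧ (∀ x, f x ≤ (stab A x).card) ∧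
      Q ≤ 4 * h * ∑ x ∈ V, f x ∧
      ((V - V).card : ℝ) * Q ^ 3 ≤ 4096 * h ^ 2 * ((A.card : ℝ) ^ 2) ^ 4 := by
  classical
  set D := A - A with hD
  set r : G → ℝ := fun x => ((stab A x).card : ℝ) with hr
  set N : ℝ := (A.card : ℝ) with hN
  set E : ℝ := (energy A : ℝ) with hE
  have hN0 : 0 < N := by rw [hN]; exact_mod_cast hA.card_pos
  have r0 : ∀ x, 0 ≤ r x := fun x => Nat.cast_nonneg _
  have rD : ∀ x, x ∉ D → r x = 0 := fun x hx => by
    simp only [hr]; exact_mod_cast stab_supp A x hx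
  have rE : ∑ x ∈ D, r x ^ 2 = E := by
    simp only [hr, hE, energy, energyK]; push_cast; rfl
  have rN : ∑ x ∈ D, r x ≤ N ^ 2 := by
    simp only [hr, hN]; exact_mod_cast sum_stab A
  have hE0 : 0 < E := by
    obtain ⟨a, ha⟩ := hA
    have h0 : (0 : G) ∈ D := by
      rw [hD, ← sub_self a]
      exact Finset.sub_mem_sub ha ha
    have h1 : 0 < r 0 := by
      simp only [hr]
      exact_mod_cast Finset.card_pos.2 ⟨a, (mem_stab' A 0 a).2 ⟨ha, by simpa using ha⟩⟩
    rw [← rE]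
    exact lt_of_lt_of_le (by positivity) (Finset.single_le_sum (f := fun x => r x ^ 2)
      (fun x _ => by positivity) h0)
  have hM0 : 0 < M := by linarith
  set h : ℝ := 8 * E * M / N ^ 2 with hh
  have hh0 : 0 < h := by positivity
  set f : G → ℝ := fun x => if r x ≤ h then r x else 0 with hf
  set g : G → ℝ := fun x => if r x ≤ h then 0 else r x with hg
  have hfg : ∀ x, r x = f x + g x := fun x => by simp only [hf, hg]; split_ifs <;> simp
  have f0 : ∀ x, 0 ≤ f x := fun x => by simp only [hf]; split_ifs; exacts [r0 x, le_rfl]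
  have g0 : ∀ x, 0 ≤ g x := fun x => by simp only [hg]; split_ifs; exacts [le_rfl, r0 x]
  have fr : ∀ x, f x ≤ r x := fun x => by linarith [hfg x, g0 x]
  have gr : ∀ x, g x ≤ r x := fun x => by linarith [hfg x, f0 x]
  have fh : ∀ x, f x ≤ h := fun x => by
    simp only [hf]; split_ifs with h'
    exacts [h', hh0.le]
  have fD : ∀ x, x ∉ D → f x = 0 := fun x hx => le_antisymm ((fr x).trans (rD x hx).le) (f0 x)
  have gD : ∀ x, x ∉ D → g x = 0 := fun x hx => le_antisymm ((gr x).trans (rD x hx).le) (g0 x)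
  have hgE : h * ∑ x ∈ D, g x ≤ E := by
    rw [← rE, Finset.mul_sum]
    refine Finset.sum_le_sum fun x _ => ?_
    simp only [hg]
    split_ifs with h'
    · rw [mul_zero]; exact sq_nonneg _
    · rw [sq]
      exact mul_le_mul_of_nonneg_right (not_le.1 h').le (r0 x)
  have RE : ∀ s, corr D r s ≤ E := by
    intro s
    have h1 : corr D r s ≤ ∑ x ∈ D, (r x ^ 2 / 2 + r (x + s) ^ 2 / 2) := by
      refine Finset.sum_le_sum fun x _ => ?_
      nlinarith [sq_nonneg (r x - r (x + s))]
    have h2 := aux_sum D D (fun x => r x ^ 2) (fun x => x + s) (add_left_injective s)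
      (fun x => sq_nonneg _) (fun x hx => by simp [rD x hx])
    rw [Finset.sum_add_distrib, ← Finset.sum_div, ← Finset.sum_div] at h1
    linarith
  have F0 : ∀ s, 0 ≤ corr D f s := corr_nonneg D f f0
  have FR : ∀ s, corr D f s ≤ corr D r s := fun s =>
    Finset.sum_le_sum fun x _ => mul_le_mul (fr _) (fr _) (f0 _) (r0 _)
  have RFsum : ∑ s ∈ D - D, (corr D r s - corr D f s) ≤ 2 * N ^ 2 * ∑ x ∈ D, g x := by
    have hg0 : 0 ≤ ∑ x ∈ D, g x := Finset.sum_nonneg fun x _ => g0 x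
    calc _ ≤ ∑ s ∈ D - D, ∑ x ∈ D, (g x * r (x + s) + r x * g (x + s)) := by
          refine Finset.sum_le_sum fun s _ => ?_
          unfold corr
          rw [← Finset.sum_sub_distrib]
          refine Finset.sum_le_sum fun x _ => ?_
          rw [hfg x, hfg (x + s)]
          nlinarith [mul_nonneg (g0 x) (g0 (x + s))]
      _ = ∑ x ∈ D, (g x * ∑ s ∈ D - D, r (x + s) + r x * ∑ s ∈ D - D, g (x + s)) := by
          rw [Finset.sum_comm]
          refine Finset.sum_congr rfl fun x _ => ?_
          rw [Finset.sum_add_distrib, Finset.mul_sum, Finset.mul_sum]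
      _ ≤ ∑ x ∈ D, (g x * N ^ 2 + r x * ∑ x ∈ D, g x) := by
          refine Finset.sum_le_sum fun x _ => add_le_add ?_ ?_
          · exact mul_le_mul_of_nonneg_left ((aux_sum (D - D) D r (fun s => x + s)
              (add_right_injective x) r0 rD).trans rN) (g0 x)
          · exact mul_le_mul_of_nonneg_left (aux_sum (D - D) D g (fun s => x + s)
              (add_right_injective x) g0 gD) (r0 x)
      _ ≤ _ := by
          rw [Finset.sum_add_distrib, ← Finset.sum_mul, ← Finset.sum_mul]
          nlinarith [mul_le_mul_of_nonneg_right rN hg0]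
  have hTR : N ^ 4 * E / M ≤ ∑ s ∈ D - D, corr D r s ^ 2 := by
    refine hT.trans ?_
    have h1 : (Tk 4 A : ℝ) ≤ ∑ s ∈ D - D, ((quad A s).card : ℝ) ^ 2 := by
      exact_mod_cast Tk_le A
    refine h1.trans (Finset.sum_le_sum fun s _ => ?_)
    refine pow_le_pow_left₀ (Nat.cast_nonneg _) ?_ 2
    simp only [corr, hr]
    exact_mod_cast quad_card A s
  have hdiff : ∑ s ∈ D - D, corr D r s ^ 2 - ∑ s ∈ D - D, corr D f s ^ 2
      ≤ N ^ 4 * E / (2 * M) := by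
    calc _ ≤ ∑ s ∈ D - D, 2 * E * (corr D r s - corr D f s) := by
          rw [← Finset.sum_sub_distrib]
          refine Finset.sum_le_sum fun s _ => ?_
          nlinarith [RE s, F0 s, FR s]
      _ ≤ 2 * E * (2 * N ^ 2 * ∑ x ∈ D, g x) := by
          rw [← Finset.mul_sum]
          exact mul_le_mul_of_nonneg_left RFsum (by linarith)
      _ ≤ 2 * E * (2 * N ^ 2 * (E / h)) := by
          have : ∑ x ∈ D, g x ≤ E / h := by
            rw [le_div_iff₀ hh0, mul_comm]; exact hgE
          exact mul_le_mul_of_nonneg_left (mul_le_mul_of_nonneg_left this (by linarith [sq_nonneg N]))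
            (by linarith)
      _ = N ^ 4 * E / (2 * M) := by
          rw [hh]; field_simp; norm_num
  obtain ⟨V, -, hV1, hV2⟩ := core D f f0 fD h (N ^ 2) (E / (2 * M)) hh0 (pow_pos hN0 2)
    (div_pos hE0 (by linarith)) fh ((Finset.sum_le_sum fun x _ => fr x).trans rN) (by
      have e : (N ^ 2) ^ 2 * (E / (2 * M)) = N ^ 4 * E / M - N ^ 4 * E / (2 * M) := by
        field_simp; ring
      rw [e]; linarith)
  exact ⟨hE0, f, V, h, E / (2 * M), rfl, rfl, fh, fr, hV1, hV2⟩

theorem stmt_2 :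
    ∃ c C : ℝ, 0 < c ∧ 0 < C ∧
      ∀ (G : Type u) [AddCommGroup G] [DecidableEq G] (A : Finset G) (M : ℝ),
        2 ≤ A.card → 1 ≤ M →
        (A.card : ℝ) ^ 4 * (energy A : ℝ) / M ≤ (Tk 4 A : ℝ) →
        ∃ A' : Finset G, A' ⊆ A ∧
          c * (A.card : ℝ) / (M ^ 3 * (Real.logb 2 (A.card : ℝ)) ^ ((16 : ℝ) / 3)) ≤
            (A'.card : ℝ) ∧
          ∀ n m : ℕ, 1 ≤ n → 1 ≤ m →
            ((iterSum A' n - iterSum A' m).card : ℝ) ≤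
              (C * M ^ 3 * (Real.logb 2 (A.card : ℝ)) ^ 4) ^ (4 * (n + m)) * M *
                ((A.card : ℝ) ^ 3 / (energy A : ℝ)) * (A'.card : ℝ) := by
  refine ⟨1 / 64, 2 ^ 11, by norm_num, by norm_num, ?_⟩
  intro G _ _ A M hA2 hM hT
  have hAne : A.Nonempty := Finset.card_pos.1 (by omega)
  obtain ⟨hE0, f, V, h, Q, hh, hQ, fh, fr, hV1, hV2⟩ := main_step A M hAne hM hT
  obtain ⟨a, ha, hshift⟩ := exists_shift A V hAne
  set N : ℝ := (A.card : ℝ) with hN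
  set E : ℝ := (energy A : ℝ) with hE
  have hN2 : 2 ≤ N := by rw [hN]; exact_mod_cast hA2
  have hN0 : 0 < N := by linarith
  have hM0 : 0 < M := by linarith
  set A' := A.filter (fun x => x - a ∈ V) with hA'
  set L := Real.logb 2 N with hL
  have hL1 : 1 ≤ L := by
    rw [hL, Real.le_logb_iff_rpow_le (by norm_num) hN0]
    simpa using hN2
  have hh0 : 0 < h := by rw [hh]; positivity
  have hQ0 : 0 < Q := by rw [hQ]; positivity
  have hfV : N ^ 2 / (64 * M ^ 2) ≤ ∑ x ∈ V, f x := by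
    have e : N ^ 2 / (64 * M ^ 2) = Q / (4 * h) := by
      rw [hQ, hh]; field_simp; norm_num
    rw [e, div_le_iff₀ (by positivity), mul_comm]
    exact hV1
  have hA'card : N / (64 * M ^ 2) ≤ (A'.card : ℝ) := by
    have h1 : N ^ 2 / (64 * M ^ 2) ≤ N * (A'.card : ℝ) :=
      (hfV.trans (Finset.sum_le_sum fun x _ => fr x)).trans hshift
    have h2 : N ^ 2 / (64 * M ^ 2) = N * (N / (64 * M ^ 2)) := by ring
    rw [h2] at h1
    exact le_of_mul_le_mul_left h1 hN0
  have hVlow : N ^ 4 / (2 ^ 9 * M ^ 3 * E) ≤ (V.card : ℝ) := by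
    have h1 : ∑ x ∈ V, f x ≤ V.card * h := by
      have := Finset.sum_le_card_nsmul V f h (fun x _ => fh x)
      rwa [nsmul_eq_mul] at this
    have e : N ^ 4 / (2 ^ 9 * M ^ 3 * E) = N ^ 2 / (64 * M ^ 2) / h := by
      rw [hh]; field_simp; norm_num
    rw [e, div_le_iff₀ hh0]
    exact hfV.trans h1
  have hVpos : (0 : ℝ) < V.card := lt_of_lt_of_le (by positivity) hVlow
  have hVne : V.Nonempty := Finset.card_pos.1 (by exact_mod_cast hVpos)
  have hVV : ((V - V).card : ℝ) ≤ 2 ^ 21 * M ^ 5 * N ^ 4 / E := by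
    have e : 2 ^ 21 * M ^ 5 * N ^ 4 / E = 4096 * h ^ 2 * (N ^ 2) ^ 4 / Q ^ 3 := by
      rw [hQ, hh]; field_simp; norm_num
    rw [e, le_div_iff₀ (by positivity)]
    exact hV2
  have hdoub : ((V - V).card : ℝ) / V.card ≤ 2 ^ 30 * M ^ 8 := by
    rw [div_le_iff₀ hVpos]
    refine hVV.trans ?_
    have e : 2 ^ 21 * M ^ 5 * N ^ 4 / E
        = 2 ^ 30 * M ^ 8 * (N ^ 4 / (2 ^ 9 * M ^ 3 * E)) := by
      field_simp
    rw [e]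
    exact mul_le_mul_of_nonneg_left hVlow (by positivity)
  have hVup : (V.card : ℝ) ≤ 2 ^ 27 * M ^ 7 * (N ^ 3 / E) * (A'.card : ℝ) := by
    have h1 : (V.card : ℝ) ≤ (V - V).card := by
      have := Finset.card_le_card_sub_right (s := V) hVne
      exact_mod_cast this
    refine (h1.trans hVV).trans ?_
    have e : 2 ^ 21 * M ^ 5 * N ^ 4 / E
        = 2 ^ 27 * M ^ 7 * (N ^ 3 / E) * (N / (64 * M ^ 2)) := by
      field_simp; norm_num
    rw [e]
    exact mul_le_mul_of_nonneg_left hA'card (by positivity)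
  refine ⟨A', Finset.filter_subset _ _, ?_, ?_⟩
  · refine le_trans ?_ hA'card
    have hL2 : 1 ≤ L ^ ((16 : ℝ) / 3) := Real.one_le_rpow hL1 (by norm_num)
    have h1 : M ^ 2 ≤ M ^ 3 * L ^ ((16 : ℝ) / 3) := by
      have : M ^ 2 ≤ M ^ 3 := pow_le_pow_right₀ hM (by norm_num)
      nlinarith [pow_pos hM0 3]
    have e : N / (64 * M ^ 2) = 1 / 64 * N / M ^ 2 := by field_simp
    rw [e]
    exact div_le_div_of_nonneg_left (by positivity) (by positivity) h1
  · intro n m hn hm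
    have hsub : A' ⊆ V + {a} := by
      intro x hx
      have hx := (Finset.mem_filter.1 hx).2
      have := Finset.add_mem_add hx (Finset.mem_singleton_self a)
      simpa using this
    have h1 := iter_card A' V a hsub n m
    have h2 : ((n • V - m • V).card : ℝ) ≤
        (((V - V).card : ℝ) / V.card) ^ (n + m) * V.card := by
      have := Finset.pluennecke_ruzsa_inequality_nsmul_sub_nsmul_sub hVne V n m
      have := (NNRat.cast_le (K := ℝ)).2 this
      push_cast at this
      exact this
    have hk : 2 ≤ n + m := by omega
    generalize n + m = k at h2 hk ⊢
    have h3 : ((iterSum A' n - iterSum A' m).card : ℝ) ≤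
        (2 ^ 30 * M ^ 8) ^ k * (2 ^ 27 * M ^ 7 * (N ^ 3 / E) * (A'.card : ℝ)) := by
      refine le_trans (by exact_mod_cast h1) (h2.trans ?_)
      exact mul_le_mul (pow_le_pow_left₀ (by positivity) hdoub k) hVup hVpos.le (by positivity)
    refine h3.trans ?_
    have h4 : (2 : ℝ) ^ 27 * M ^ 7 ≤ (2 ^ 14 * M ^ 4) ^ k := by
      calc (2 : ℝ) ^ 27 * M ^ 7 ≤ 2 ^ 28 * M ^ 8 :=
            mul_le_mul (by norm_num) (pow_le_pow_right₀ hM (by norm_num)) (by positivity)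
              (by positivity)
        _ = (2 ^ 14 * M ^ 4) ^ 2 := by ring
        _ ≤ _ := pow_le_pow_right₀ (by
              have : 1 ≤ M ^ 4 := one_le_pow₀ hM
              linarith) hk
    have h5 : (2 ^ 30 * M ^ 8) ^ k * (2 ^ 27 * M ^ 7) ≤
        (2 ^ 11 * M ^ 3 * L ^ 4) ^ (4 * k) * M := by
      calc (2 ^ 30 * M ^ 8) ^ k * (2 ^ 27 * M ^ 7)
          ≤ (2 ^ 30 * M ^ 8) ^ k * (2 ^ 14 * M ^ 4) ^ k :=
            mul_le_mul_of_nonneg_left h4 (by positivity)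
        _ = (2 ^ 11 * M ^ 3 * 1) ^ (4 * k) * 1 := by
            rw [← mul_pow, pow_mul, mul_one]
            congr 1
            ring
        _ ≤ _ := by
            have : 1 ≤ L ^ 4 := one_le_pow₀ hL1
            gcongr
    calc _ = (2 ^ 30 * M ^ 8) ^ k * (2 ^ 27 * M ^ 7) * (N ^ 3 / E) * (A'.card : ℝ) := by ring
      _ ≤ _ := by gcongr
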